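/- Let a, b ≥ 1, let α ∈ P(a,b) (a partition with at most a parts, each part at most b) and β ∈ P(b,a) (at most b parts, each part at most a). Then D_{a+b} applied to the monomial x_1^{a−1+α_1} x_2^{a−2+α_2} ⋯ x_{a−1}^{1+α_{a−1}} x_a^{α_a} x_{a+1}^{β_b} x_{a+2}^{1+β_{b−1}} ⋯ x_{a+b−1}^{b−2+β_2} x_{a+b}^{b−1+β_1} in OPol_{a+b} equals (−1)^{Ω(β)+C(a+b,3)} if α = β̂, and 0 otherwise; here Ω(β) = Σ_{j=0}^{b−1} C(β_{b−j}+j, 3) with C(n,3) = n(n−1)(n−2)/6, and β̂ denotes the conjugate (transpose) of the complementary partition (a−β_b, a−β_{b−1}, …, a−β_1) of β in the b×a box. -/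

import Mathlib

open scoped BigOperators

/-- The defining anticommutation relations of the odd polynomial ring. -/
inductive OddRel (a : ℕ) : FreeAlgebra ℤ (Fin a) → FreeAlgebra ℤ (Fin a) → Prop
  | anticomm (i j : Fin a) (h : i ≠ j) :
      OddRel a (FreeAlgebra.ι ℤ i * FreeAlgebra.ι ℤ j)
        (-(FreeAlgebra.ι ℤ j * FreeAlgebra.ι ℤ i))

/-- The ring of odd polynomials in `a` variables over `ℤ`. -/
abbrev OPol (a : ℕ) : Type := RingQuot (OddRel a)

/-- The variable `x_{i+1}` (`0`-based index). -/
noncomputable def OX {a : ℕ} (i : Fin a) : OPol a :=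
  RingQuot.mkRingHom (OddRel a) (FreeAlgebra.ι ℤ i)

/-- The variable `x_i` (`1`-based index), `0` if out of range. -/
noncomputable def xv (a : ℕ) (i : ℕ) : OPol a :=
  if h : 1 ≤ i ∧ i ≤ a then OX ⟨i - 1, by omega⟩ else 0

/-- The signed variable `x̃_i = (−1)^{i−1} x_i` (`0`-based index, so the sign is `(−1)^i`). -/
noncomputable def xt (a : ℕ) (i : Fin a) : OPol a := (-1 : OPol a) ^ (i : ℕ) * OX i

/-- Odd elementary symmetric polynomial `ε_k`. -/
noncomputable def eps (a k : ℕ) : OPol a :=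
  ∑ t ∈ Finset.powersetCard k (Finset.univ : Finset (Fin a)),
    ((t.sort (· ≤ ·)).map (xt a)).prod

/-- Odd complete symmetric polynomial `h_k`. -/
noncomputable def hp (a k : ℕ) : OPol a :=
  ∑ σ : Sym (Fin a) k, (((σ : Multiset (Fin a)).sort (· ≤ ·)).map (xt a)).prod

/-- The ordered monomial `x_1^{c_1} ⋯ x_a^{c_a}`. -/
noncomputable def xmon {a : ℕ} (c : Fin a → ℕ) : OPol a :=
  ((List.finRange a).map fun i => OX i ^ c i).prod

/-- The staircase monomial `x^{δ_a} = x_1^{a−1} x_2^{a−2} ⋯ x_a^0`. -/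
noncomputable def xdelta (a : ℕ) : OPol a :=
  ((List.finRange a).map fun i => OX i ^ (a - 1 - (i : ℕ))).prod

/-- Composite of the operators `d i` along a word, leftmost letter acting last (outermost). -/
noncomputable def dword {a : ℕ} (d : ℕ → OPol a →+ OPol a) : List ℕ → (OPol a →+ OPol a)
  | [] => AddMonoidHom.id _
  | i :: l => (d i).comp (dword d l)

/-- The word `1, (2,1), (3,2,1), …, (a−1,…,2,1)` for the longest element, so that
`dword d (DList a) = ∂_1∘(∂_2∘∂_1)∘⋯∘(∂_{a−1}∘⋯∘∂_1) = D_a`. -/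
def DList (a : ℕ) : List ℕ :=
  ((List.range a).map fun b => (List.range b).reverse.map (· + 1)).flatten

/-- Left multiplication by `f` as a `ℤ`-linear endomorphism. -/
noncomputable def mulL {a : ℕ} (f : OPol a) : Module.End ℤ (OPol a) :=
  (AddMonoidHom.mulLeft f).toIntLinearMap

/-- The generators of the odd nilHecke ring inside `End_ℤ(OPol a)`. -/
noncomputable def onhGens (a : ℕ) (d : ℕ → OPol a →+ OPol a) :
    Set (Module.End ℤ (OPol a)) :=
  {T | (∃ i : Fin a, T = mulL (OX i)) ∨
    (∃ i : ℕ, 1 ≤ i ∧ i + 1 ≤ a ∧ T = (d i).toIntLinearMap)}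

/-- The simple transposition `s_i` (`1`-based) of `{1,…,a}`. -/
def sperm (a : ℕ) (i : ℕ) : Equiv.Perm (Fin a) :=
  if h : 1 ≤ i ∧ i + 1 ≤ a then Equiv.swap ⟨i - 1, by omega⟩ ⟨i, by omega⟩ else 1

/-- The permutation associated to a word in the simple transpositions. -/
def wordPerm (a : ℕ) (l : List ℕ) : Equiv.Perm (Fin a) := (l.map (sperm a)).prod

/-- Evaluation of an (even) multivariate polynomial at the squared variables `x_1², …, x_a²`. -/
noncomputable def sqEval {a : ℕ} (p : MvPolynomial (Fin a) ℤ) : OPol a :=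
  ∑ m ∈ p.support,
    MvPolynomial.coeff m p • ((List.finRange a).map fun i => OX i ^ (2 * m i)).prod

/-- The odd symmetrization operator `S(f) = (−1)^{C(a,3)} w₀(D_a(f·x^{δ_a}))`. -/
noncomputable def oddSymzn (a : ℕ) (d : ℕ → OPol a →+ OPol a) (W0 : OPol a →+* OPol a)
    (f : OPol a) : OPol a :=
  (-1 : OPol a) ^ Nat.choose a 3 * W0 (dword d (DList a) (f * xdelta a))

/-- The odd Schur polynomial `s_α = (−1)^{C(a,3)} w₀(D_a(x^α·x^{δ_a}))`. -/
noncomputable def schurP (a : ℕ) (d : ℕ → OPol a →+ OPol a) (W0 : OPol a →+* OPol a)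
    (α : Fin a → ℕ) : OPol a :=
  (-1 : OPol a) ^ Nat.choose a 3 * W0 (dword d (DList a) (xmon α * xdelta a))

/-- The 0-Hecke generator `∂̄_r = x_r ∘ ∂_r`. -/
noncomputable def dbar (a : ℕ) (d : ℕ → OPol a →+ OPol a) (r : ℕ) : OPol a →+ OPol a :=
  (AddMonoidHom.mulLeft (xv a r)).comp (d r)

/-- The `ℤ`-span of products of exactly `n` variables: the degree-`2n` component of `OPol a`. -/
def degComp (a n : ℕ) : Submodule ℤ (OPol a) :=
  Submodule.span ℤ {f : OPol a | ∃ l : List (Fin a), l.length = n ∧ f = (l.map OX).prod}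

/-- Odd Schubert polynomial `𝔰_w = ∂_{w⁻¹w₀}(x^{δ_a})` for a fixed choice `red` of
reduced expressions. -/
noncomputable def schubert (a : ℕ) (d : ℕ → OPol a →+ OPol a)
    (red : Equiv.Perm (Fin a) → List ℕ) (w : Equiv.Perm (Fin a)) : OPol a :=
  dword d (red (w⁻¹ * Fin.revPerm)) (xdelta a)

/-- Product of odd elementary symmetric polynomials along the parts of a partition,
in non-increasing order. -/
noncomputable def epsPart (a : ℕ) {n : ℕ} (p : Nat.Partition n) : OPol a :=
  (((p.parts.sort (· ≤ ·)).reverse).map (eps a)).prod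

/-! ### Words in a ring with odd nil-Coxeter relations -/

section Words

variable {R : Type*} [Ring R] (d : ℕ → R)

/-- The product `d_{l+k-1} ⋯ d_{l+1} d_l`. -/
def upWord (l : ℕ) : ℕ → R
  | 0 => 1
  | k + 1 => d (l + k) * upWord l k

/-- The product `d_l d_{l+1} ⋯ d_{l+k-1}`. -/
def downWord (l : ℕ) : ℕ → R
  | 0 => 1
  | k + 1 => downWord l k * d (l + k)

/-- The product over the longest word on the `m` strands `l, …, l+m-1`. -/
def longWord (l : ℕ) : ℕ → R
  | 0 => 1
  | k + 1 => longWord l k * upWord d l k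

variable {d}

theorem upWord_succ' (l k : ℕ) : upWord d l (k + 1) = upWord d (l + 1) k * d l := by
  induction k with
  | zero => simp [upWord]
  | succ k ih =>
    rw [upWord, ih, upWord, mul_assoc, show l + (k + 1) = l + 1 + k by ring]

theorem neg_one_pow_central (n : ℕ) (r : R) : r * (-1) ^ n = (-1) ^ n * r :=
  ((Commute.neg_one_right r).pow_right n).eq

theorem upWord_skew {y : R} {l k : ℕ}
    (h : ∀ i, l ≤ i → i < l + k → d i * y = -(y * d i)) :
    upWord d l k * y = (-1) ^ k * (y * upWord d l k) := by
  induction k with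
  | zero => simp [upWord]
  | succ k ih =>
    rw [upWord, mul_assoc, ih fun i h1 h2 => h i h1 (by omega), ← mul_assoc,
      neg_one_pow_central, mul_assoc, ← mul_assoc (d _), h _ (by omega) (by omega), pow_succ]
    simp [mul_assoc]

theorem longWord_skew {y : R} {l k : ℕ}
    (h : ∀ i, l ≤ i → i + 1 < l + k → d i * y = -(y * d i)) :
    longWord d l k * y = (-1) ^ k.choose 2 * (y * longWord d l k) := by
  induction k with
  | zero => simp [longWord]
  | succ k ih =>
    rw [longWord, mul_assoc, upWord_skew fun i h1 h2 => h i h1 (by omega), ← mul_assoc,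
      neg_one_pow_central, mul_assoc, ← mul_assoc (longWord _ _ _),
      ih fun i h1 h2 => h i h1 (by omega), Nat.choose_succ_succ' k 1, Nat.choose_one_right, pow_add]
    simp only [mul_assoc]

theorem upWord_commute {y : R} {l k : ℕ} (h : ∀ i, l ≤ i → i < l + k → Commute (d i) y) :
    Commute (upWord d l k) y := by
  induction k with
  | zero => exact Commute.one_left y
  | succ k ih =>
    exact (h _ (by omega) (by omega)).mul_left (ih fun i h1 h2 => h i h1 (by omega))

theorem downWord_commute {y : R} {l k : ℕ} (h : ∀ i, l ≤ i → i < l + k → Commute (d i) y) :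
    Commute (downWord d l k) y := by
  induction k with
  | zero => exact Commute.one_left y
  | succ k ih =>
    exact (ih fun i h1 h2 => h i h1 (by omega)).mul_left (h _ (by omega) (by omega))

theorem longWord_commute {y : R} {l k : ℕ} (h : ∀ i, l ≤ i → i + 1 < l + k → Commute (d i) y) :
    Commute (longWord d l k) y := by
  induction k with
  | zero => exact Commute.one_left y
  | succ k ih =>
    exact (ih fun i h1 h2 => h i h1 (by omega)).mul_left
      (upWord_commute fun i h1 h2 => h i h1 (by omega))

theorem skew_pow {T y : R} {c : ℕ} (h : T * y = (-1) ^ c * (y * T)) (p : ℕ) :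
    T * y ^ p = (-1) ^ (c * p) * (y ^ p * T) := by
  induction p with
  | zero => simp
  | succ p ih =>
    rw [pow_succ, ← mul_assoc, ih, mul_assoc, mul_assoc, h, ← mul_assoc (y ^ p),
      neg_one_pow_central, mul_add, pow_add]
    simp only [mul_assoc, mul_one]

variable (hfar : ∀ i j, i + 2 ≤ j → d j * d i = -(d i * d j))
  (hbraid : ∀ i, d i * d (i + 1) * d i = d (i + 1) * d i * d (i + 1))

include hfar hbraid in
theorem upWord_conj {l k i : ℕ} (h1 : l ≤ i) (h2 : i + 1 < l + k) :
    d i * upWord d l k = (-1) ^ k * (upWord d l k * d (i + 1)) := by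
  induction k with
  | zero => omega
  | succ k ih =>
    by_cases h : i + 1 < l + k
    · have h3 : d i * d (l + k) = -(d (l + k) * d i) := by
        rw [hfar i (l + k) (by omega), neg_neg]
      rw [upWord, ← mul_assoc, h3, neg_mul, mul_assoc, ih h, ← mul_assoc (d _),
        neg_one_pow_central, pow_succ]
      simp [mul_assoc]
    · obtain ⟨k, rfl⟩ : ∃ k', k = k' + 1 := ⟨k - 1, by omega⟩
      obtain rfl : i = l + k := by omega
      have h4 := upWord_skew (d := d) (y := d (l + k + 1)) (l := l) (k := k) fun j _ _ => by
        rw [hfar j _ (by omega), neg_neg]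
      rw [upWord, upWord, show l + (k + 1) = l + k + 1 by ring, mul_assoc (d (l + k + 1)),
        mul_assoc (d (l + k)) _ (d (l + k + 1)), h4]
      have h5 := hbraid (l + k)
      calc _ = (d (l + k) * d (l + k + 1) * d (l + k)) * upWord d l k := by simp only [mul_assoc]
        _ = (-1) ^ (k + 1 + 1) * ((-1) ^ k *
            ((d (l + k + 1) * d (l + k) * d (l + k + 1)) * upWord d l k)) := by
          rw [h5, ← mul_assoc ((-1) ^ _), ← pow_add, Even.neg_one_pow ⟨k + 1, by ring⟩, one_mul]
        _ = _ := by
          rw [← mul_assoc (d (l + k)) ((-1) ^ k), neg_one_pow_central k (d (l + k)),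
            mul_assoc ((-1) ^ k), ← mul_assoc (d (l + k + 1)) ((-1) ^ k),
            neg_one_pow_central k (d (l + k + 1))]
          simp only [mul_assoc]

include hfar hbraid in
theorem upWord_mul_upWord {l k j : ℕ} (h : j < k) :
    upWord d l j * upWord d l k = (-1) ^ (k * j) * (upWord d l k * upWord d (l + 1) j) := by
  induction j with
  | zero => simp [upWord]
  | succ j ih =>
    rw [upWord, mul_assoc, ih (by omega), ← mul_assoc (d _), neg_one_pow_central, mul_assoc,
      ← mul_assoc (d _), upWord_conj hfar hbraid (by omega) (by omega), upWord, mul_add, pow_add,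
      show l + 1 + j = l + j + 1 by ring]
    simp only [mul_assoc, mul_one]

include hfar hbraid in
theorem longWord_mul_upWord {l k j : ℕ} (h : j ≤ k) :
    longWord d l j * upWord d l k =
      (-1) ^ (k * j.choose 2) * (upWord d l k * longWord d (l + 1) j) := by
  induction j with
  | zero => simp [longWord]
  | succ j ih =>
    rw [longWord, mul_assoc, upWord_mul_upWord hfar hbraid (by omega), ← mul_assoc,
      neg_one_pow_central, mul_assoc, ← mul_assoc (longWord _ _ _), ih (by omega), longWord,
      Nat.choose_succ_succ' j 1, Nat.choose_one_right, mul_add, pow_add]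
    simp only [mul_assoc]

include hfar hbraid in
theorem longWord_succ_eq_upWord_mul (l k : ℕ) :
    longWord d l (k + 1) = (-1) ^ (k * k.choose 2) * (upWord d l k * longWord d (l + 1) k) :=
  longWord_mul_upWord hfar hbraid le_rfl

include hfar in
theorem longWord_succ_eq_downWord_mul (l k : ℕ) :
    longWord d l (k + 1) = (-1) ^ k.choose 3 * (downWord d l k * longWord d l k) := by
  induction k with
  | zero => simp [longWord, upWord, downWord]
  | succ k ih =>
    have h := longWord_skew (d := d) (y := d (l + k)) (l := l) (k := k) fun j _ _ => by
      rw [hfar j _ (by omega), neg_neg]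
    rw [longWord, ih, upWord, downWord, Nat.choose_succ_succ' k 2, mul_assoc, mul_assoc,
      ← mul_assoc (longWord d l k), h, ← ih,
      show longWord d l (k + 1) = longWord d l k * upWord d l k from rfl, add_comm (k.choose 2),
      pow_add,
      mul_assoc ((-1) ^ k.choose 2), ← mul_assoc (downWord d l k), neg_one_pow_central]
    simp only [mul_assoc]

end Words

/-! ### The odd polynomial ring and its odd divided differences -/

section OddPolynomials

variable {A : Type*} [Ring A] {n : ℕ}

/-- Left multiplication as an additive endomorphism. -/
def mulLeftEnd (y : A) : AddMonoid.End A := AddMonoidHom.mulLeft y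

/-- Right multiplication as an additive endomorphism. -/
def mulRightEnd (y : A) : AddMonoid.End A := AddMonoidHom.mulRight y

theorem end_mul_apply (S T : AddMonoid.End A) (f : A) : (S * T) f = S (T f) := rfl

theorem neg_one_pow_end_apply (c : ℕ) (f : A) : ((-1 : AddMonoid.End A) ^ c) f = (-1) ^ c * f := by
  induction c with
  | zero => simp
  | succ c ih =>
    rw [pow_succ', end_mul_apply, ih, pow_succ', neg_one_mul, neg_mul]; rfl

theorem mulLeft_pow_apply (y f : A) (p : ℕ) :
    (mulLeftEnd y ^ p) f = y ^ p * f := by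
  induction p generalizing f with
  | zero => simp
  | succ p ih =>
    rw [pow_succ, end_mul_apply, ih, pow_succ, mul_assoc]; rfl

theorem end_apply_pow_mul {T : AddMonoid.End A} {y : A} {c : ℕ}
    (h : T * mulLeftEnd y =
      (-1) ^ c * (mulLeftEnd y * T)) (p : ℕ) (f : A) :
    T (y ^ p * f) = (-1) ^ (c * p) * (y ^ p * T f) := by
  have := DFunLike.congr_fun (skew_pow h p) f
  simpa only [end_mul_apply, mulLeft_pow_apply, neg_one_pow_end_apply] using this

theorem end_apply_mul_pow {T : AddMonoid.End A} {y : A}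
    (h : Commute T (mulRightEnd y)) (p : ℕ) (f : A) :
    T (f * y ^ p) = T f * y ^ p := by
  induction p with
  | zero => simp
  | succ p ih =>
    rw [pow_succ, ← mul_assoc, ← mul_assoc, ← ih]
    exact DFunLike.congr_fun h.eq (f * y ^ p)

theorem end_apply_neg_one_pow_mul (T : AddMonoid.End A) (c : ℕ) (f : A) :
    T ((-1) ^ c * f) = (-1) ^ c * T f := by
  rcases neg_one_pow_eq_or A c with h | h <;> simp [h]

theorem neg_one_pow_mul_mem {S : AddSubgroup A} {g : A} (hg : g ∈ S) (c : ℕ) :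
    (-1) ^ c * g ∈ S := by
  rcases neg_one_pow_eq_or A c with h | h <;> simp [h, hg]

theorem map_mem_of_mem_closure {G : Set A} {S : AddSubgroup A} (T : AddMonoid.End A)
    (h : ∀ g ∈ G, T g ∈ S) {f : A} (hf : f ∈ AddSubgroup.closure G) : T f ∈ S :=
  (AddSubgroup.closure_le (S.comap T)).2 h hf

/-- The ordered monomial `x_l^{c_0} x_{l+1}^{c_1} ⋯` for the list of exponents `c_0, c_1, …`. -/
def oddMon (x : ℕ → A) : ℕ → List ℕ → A
  | _, [] => 1
  | l, p :: cs => x l ^ p * oddMon x (l + 1) cs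

theorem oddMon_append (x : ℕ → A) (l : ℕ) (cs ds : List ℕ) :
    oddMon x l (cs ++ ds) = oddMon x l cs * oddMon x (l + cs.length) ds := by
  induction cs generalizing l with
  | nil => simp [oddMon]
  | cons p cs ih =>
    rw [List.cons_append, oddMon, ih, oddMon, List.length_cons, mul_assoc,
      show l + 1 + cs.length = l + (cs.length + 1) by ring]

theorem oddMon_concat (x : ℕ → A) (l : ℕ) (cs : List ℕ) (t : ℕ) :
    oddMon x l (cs ++ [t]) = oddMon x l cs * x (l + cs.length) ^ t := by
  rw [oddMon_append, oddMon, oddMon, mul_one]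

/-- `x` is a system of generators of the ring `A` behaving like the `n` variables of the odd
polynomial ring (extended by zero outside `1 ≤ i ≤ n`), and `d` consists of the odd divided
differences with respect to `x`, twisted by `s` and extended by zero outside `1 ≤ i < n`. -/
structure IsOddDiff (n : ℕ) (x : ℕ → A) (s : ℕ → A →+* A) (d : ℕ → AddMonoid.End A) :
    Prop where
  x_out : ∀ j, ¬(1 ≤ j ∧ j ≤ n) → x j = 0
  x_anticomm : ∀ i j, i ≠ j → x i * x j = -(x j * x i)
  x_closure : Subring.closure (x '' Set.Icc 1 n) = ⊤
  x_eval : ∀ j, ∃ φ : A →+* ℤ, ∀ i, 1 ≤ i → i ≤ n → φ (x i) = if i = j then 1 else 0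
  s_x : ∀ i j : ℕ, 1 ≤ i → i + 1 ≤ n → 1 ≤ j → j ≤ n →
      s i (x j) = if j = i then -x (i + 1) else if j = i + 1 then -x i else -x j
  d_one : ∀ i : ℕ, 1 ≤ i → i + 1 ≤ n → d i 1 = 0
  d_x : ∀ i j : ℕ, 1 ≤ i → i + 1 ≤ n → 1 ≤ j → j ≤ n →
      d i (x j) = if j = i ∨ j = i + 1 then 1 else 0
  d_mul : ∀ i : ℕ, 1 ≤ i → i + 1 ≤ n → ∀ f g : A, d i (f * g) = d i f * g + s i f * d i g
  d_out : ∀ i : ℕ, ¬(1 ≤ i ∧ i + 1 ≤ n) → d i = 0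

namespace IsOddDiff

variable {x : ℕ → A} {s : ℕ → A →+* A} {d : ℕ → AddMonoid.End A} (H : IsOddDiff n x s d)
include H

theorem x_pow_mul_x_pow {i j : ℕ} (h : i ≠ j) (p q : ℕ) :
    x i ^ p * x j ^ q = (-1) ^ (p * q) * (x j ^ q * x i ^ p) := by
  have h1 : x i * x j = (-1) ^ 1 * (x j * x i) := by simp [H.x_anticomm i j h]
  have h2 := skew_pow h1 q
  have h3 : x j ^ q * x i = (-1) ^ q * (x i * x j ^ q) := by
    rw [h2, ← mul_assoc, ← pow_add, Even.neg_one_pow ⟨q, by ring⟩, one_mul]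
  rw [skew_pow h3 p, ← mul_assoc, ← pow_add, Even.neg_one_pow ⟨q * p, by ring⟩, one_mul]

theorem induction_on_x {P : A → Prop} (h1 : P 1) (hadd : ∀ f g, P f → P g → P (f + g))
    (hneg : ∀ f, P f → P (-f))
    (hx : ∀ j f, 1 ≤ j → j ≤ n → P f → P (x j * f)) (f : A) : P f := by
  have h0 : P 0 := by simpa using hadd _ _ h1 (hneg _ h1)
  suffices h : ∀ g, P g → P (f * g) by simpa using h 1 h1
  have hf : f ∈ Subring.closure (x '' Set.Icc 1 n) := by rw [H.x_closure]; trivial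
  induction hf using Subring.closure_induction with
  | mem y hy =>
    obtain ⟨j, hj, rfl⟩ := hy
    exact fun g hg => hx j g hj.1 hj.2 hg
  | zero => intro g _; simpa using h0
  | one => intro g hg; simpa using hg
  | add a b _ _ ha hb => intro g hg; rw [add_mul]; exact hadd _ _ (ha _ hg) (hb _ hg)
  | neg a _ ha => intro g hg; rw [neg_mul]; exact hneg _ (ha _ hg)
  | mul a b _ _ ha hb => intro g hg; rw [mul_assoc]; exact ha _ (hb _ hg)

theorem d_x_left {i : ℕ} (h1 : 1 ≤ i) (h2 : i + 1 ≤ n) (f : A) :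
    d i (x i * f) = f - x (i + 1) * d i f := by
  rw [H.d_mul i h1 h2, H.d_x i i h1 h2 h1 (by omega), H.s_x i i h1 h2 h1 (by omega)]
  simp [sub_eq_add_neg]

theorem d_x_succ_left {i : ℕ} (h1 : 1 ≤ i) (h2 : i + 1 ≤ n) (f : A) :
    d i (x (i + 1) * f) = f - x i * d i f := by
  rw [H.d_mul i h1 h2, H.d_x i (i + 1) h1 h2 (by omega) h2,
    H.s_x i (i + 1) h1 h2 (by omega) h2]
  simp [sub_eq_add_neg]

theorem d_x_left_of_ne {i j : ℕ} (hj : j ≠ i) (hj' : j ≠ i + 1) (f : A) :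
    d i (x j * f) = -(x j * d i f) := by
  by_cases hi : 1 ≤ i ∧ i + 1 ≤ n
  · by_cases hjn : 1 ≤ j ∧ j ≤ n
    · rw [H.d_mul i hi.1 hi.2, H.d_x i j hi.1 hi.2 hjn.1 hjn.2,
        H.s_x i j hi.1 hi.2 hjn.1 hjn.2]
      simp [hj, hj']
    · simp [H.x_out j hjn]
  · simp [H.d_out i hi]

theorem d_x_right_of_ne {i j : ℕ} (hj : j ≠ i) (hj' : j ≠ i + 1) (f : A) :
    d i (f * x j) = d i f * x j := by
  by_cases hi : 1 ≤ i ∧ i + 1 ≤ n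
  · by_cases hjn : 1 ≤ j ∧ j ≤ n
    · rw [H.d_mul i hi.1 hi.2, H.d_x i j hi.1 hi.2 hjn.1 hjn.2]
      simp [hj, hj']
    · simp [H.x_out j hjn]
  · simp [H.d_out i hi]

theorem d_sq (i : ℕ) : d i * d i = 0 := by
  by_cases hi : 1 ≤ i ∧ i + 1 ≤ n
  · obtain ⟨h1, h2⟩ := hi
    ext f
    change d i (d i f) = 0
    induction f using H.induction_on_x with
    | h1 => simp [H.d_one i h1 h2]
    | hadd f g hf hg => simp [hf, hg]
    | hneg f hf => simp [hf]
    | hx j f _ _ hf =>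
      by_cases hj : j = i
      · subst hj
        rw [H.d_x_left h1 h2, map_sub, H.d_x_succ_left h1 h2, hf]; simp
      · by_cases hj' : j = i + 1
        · subst hj'
          rw [H.d_x_succ_left h1 h2, map_sub, H.d_x_left h1 h2, hf]; simp
        · simp [H.d_x_left_of_ne hj hj', hf]
  · simp [H.d_out i hi]

theorem d_far (i j : ℕ) (hij : i + 2 ≤ j) : d j * d i = -(d i * d j) := by
  by_cases hi : 1 ≤ i ∧ j + 1 ≤ n
  · obtain ⟨h1, h2⟩ := hi
    ext f
    change d j (d i f) = -(d i (d j f))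
    induction f using H.induction_on_x with
    | h1 => simp [H.d_one i h1 (by omega), H.d_one j (by omega) h2]
    | hadd f g hf hg => simp only [map_add, hf, hg]; abel
    | hneg f hf => simp [hf]
    | hx k f _ _ hf =>
      by_cases hk : k = i
      · subst hk
        rw [H.d_x_left h1 (by omega), map_sub, H.d_x_left_of_ne (by omega) (by omega),
          H.d_x_left_of_ne (by omega) (by omega), map_neg, H.d_x_left h1 (by omega), hf]
        simp
      by_cases hk : k = i + 1
      · subst hk
        rw [H.d_x_succ_left h1 (by omega), map_sub, H.d_x_left_of_ne (by omega) (by omega),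
          H.d_x_left_of_ne (by omega) (by omega), map_neg, H.d_x_succ_left h1 (by omega), hf]
        simp
      by_cases hk : k = j
      · subst hk
        rw [H.d_x_left (by omega) h2, map_sub, H.d_x_left_of_ne (by omega) (by omega),
          H.d_x_left_of_ne (by omega) (by omega), map_neg, H.d_x_left (by omega) h2, hf]
        simp
      by_cases hk : k = j + 1
      · subst hk
        rw [H.d_x_succ_left (by omega) h2, map_sub, H.d_x_left_of_ne (by omega) (by omega),
          H.d_x_left_of_ne (by omega) (by omega), map_neg, H.d_x_succ_left (by omega) h2, hf]
        simp
      rw [H.d_x_left_of_ne (by omega) (by omega), H.d_x_left_of_ne (by omega) (by omega),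
        map_neg, map_neg, H.d_x_left_of_ne (by omega) (by omega),
        H.d_x_left_of_ne (by omega) (by omega), hf]
      simp
  · rcases not_and_or.mp hi with h | h
    · simp [H.d_out i (by omega)]
    · simp [H.d_out j (by omega)]

theorem d_braid (i : ℕ) : d i * d (i + 1) * d i = d (i + 1) * d i * d (i + 1) := by
  by_cases hi : 1 ≤ i ∧ i + 2 ≤ n
  · obtain ⟨h1, h2⟩ := hi
    have sq : ∀ j f, d j (d j f) = 0 := fun j f => DFunLike.congr_fun (H.d_sq j) f
    have a1 := fun f => H.d_x_left h1 (by omega) f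
    have a2 := fun f => H.d_x_succ_left h1 (by omega) f
    have a3 := fun f => H.d_x_left_of_ne (i := i) (j := i + 1 + 1) (by omega) (by omega) f
    have b1 := fun f => H.d_x_left_of_ne (i := i + 1) (j := i) (by omega) (by omega) f
    have b2 := fun f => H.d_x_left (i := i + 1) (by omega) (by omega) f
    have b3 := fun f => H.d_x_succ_left (i := i + 1) (by omega) (by omega) f
    ext f
    change d i (d (i + 1) (d i f)) = d (i + 1) (d i (d (i + 1) f))
    induction f using H.induction_on_x with
    | h1 => simp [H.d_one i h1 (by omega), H.d_one (i + 1) (by omega) h2]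
    | hadd f g hf hg => simp [hf, hg]
    | hneg f hf => simp [hf]
    | hx k f _ _ hf =>
      by_cases hk : k = i
      · subst hk; simp [a1, a3, b1, b2, sq, hf]
      by_cases hk : k = i + 1
      · subst hk; simp only [a1, a2, a3, b1, b2, b3, map_sub, map_neg, hf]; simp; abel
      by_cases hk : k = i + 1 + 1
      · subst hk; simp [a2, a3, b1, b3, sq, hf]
      have a := fun f => H.d_x_left_of_ne (i := i) (j := k) (by omega) (by omega) f
      have b := fun f => H.d_x_left_of_ne (i := i + 1) (j := k) (by omega) (by omega) f
      simp [a, b, hf]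
  · rcases not_and_or.mp hi with h | h
    · simp [H.d_out i (by omega)]
    · simp [H.d_out (i + 1) (by omega)]

/-! ### Skew commutation of the words with variables -/

theorem d_mul_mulLeft {i j : ℕ} (hj : j ≠ i) (hj' : j ≠ i + 1) :
    d i * mulLeftEnd (x j) =
      -(mulLeftEnd (x j) * d i) := by
  ext f
  exact H.d_x_left_of_ne hj hj' f

theorem upWord_x_pow_mul {l k j : ℕ} (hj : j < l ∨ l + k < j) (p : ℕ) (f : A) :
    upWord d l k (x j ^ p * f) = (-1) ^ (k * p) * (x j ^ p * upWord d l k f) :=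
  end_apply_pow_mul (upWord_skew fun _ _ _ => H.d_mul_mulLeft (j := j) (by omega) (by omega)) p f

theorem longWord_x_pow_mul {l k j : ℕ} (hj : j < l ∨ l + k ≤ j) (p : ℕ) (f : A) :
    longWord d l k (x j ^ p * f) = (-1) ^ (k.choose 2 * p) * (x j ^ p * longWord d l k f) :=
  end_apply_pow_mul (longWord_skew fun _ _ _ => H.d_mul_mulLeft (j := j) (by omega) (by omega)) p f

theorem d_commute_mulRight {i j : ℕ} (hj : j ≠ i) (hj' : j ≠ i + 1) :
    Commute (d i) (mulRightEnd (x j)) := by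
  ext f
  exact H.d_x_right_of_ne hj hj' f

theorem upWord_mul_x_pow {l k j : ℕ} (hj : j < l ∨ l + k < j) (p : ℕ) (f : A) :
    upWord d l k (f * x j ^ p) = upWord d l k f * x j ^ p :=
  end_apply_mul_pow (upWord_commute fun _ _ _ => H.d_commute_mulRight (by omega) (by omega)) p f

theorem downWord_mul_x_pow {l k j : ℕ} (hj : j < l ∨ l + k < j) (p : ℕ) (f : A) :
    downWord d l k (f * x j ^ p) = downWord d l k f * x j ^ p :=
  end_apply_mul_pow (downWord_commute fun _ _ _ => H.d_commute_mulRight (by omega) (by omega)) p f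

theorem longWord_mul_x_pow {l k j : ℕ} (hj : j < l ∨ l + k ≤ j) (p : ℕ) (f : A) :
    longWord d l k (f * x j ^ p) = longWord d l k f * x j ^ p :=
  end_apply_mul_pow (longWord_commute fun _ _ _ => H.d_commute_mulRight (by omega) (by omega)) p f

/-! ### Leading powers -/

theorem d_x_pow_succ {i : ℕ} (h1 : 1 ≤ i) (h2 : i + 1 ≤ n) (j : ℕ) :
    d i (x i ^ (j + 1)) = d i (x i ^ j) * x i + (-1) ^ j * x (i + 1) ^ j := by
  rw [pow_succ, H.d_mul i h1 h2, H.d_x i i h1 h2 h1 (by omega), map_pow (s i),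
    H.s_x i i h1 h2 h1 (by omega), ← neg_pow]
  simp

theorem d_x_succ_pow_succ {i : ℕ} (h1 : 1 ≤ i) (h2 : i + 1 ≤ n) (j : ℕ) :
    d i (x (i + 1) ^ (j + 1)) = d i (x (i + 1) ^ j) * x (i + 1) + (-1) ^ j * x i ^ j := by
  rw [pow_succ, H.d_mul i h1 h2, H.d_x i (i + 1) h1 h2 (by omega) h2, map_pow (s i),
    H.s_x i (i + 1) h1 h2 (by omega) h2, ← neg_pow]
  simp

theorem upWord_x_pow {l k j : ℕ} (h1 : 1 ≤ l) (h2 : l + k ≤ n) (hj : j ≤ k) :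
    upWord d l k (x l ^ j) = if j = k then (-1) ^ k.choose 2 else 0 := by
  induction k generalizing l j with
  | zero => obtain rfl : j = 0 := by omega
            simp [upWord]
  | succ k ih =>
    rw [upWord_succ', end_mul_apply]
    induction j with
    | zero => simp [H.d_one l h1 (by omega)]
    | succ j ihj =>
      have h3 := H.upWord_mul_x_pow (l := l + 1) (k := k) (j := l) (by omega) 1 (d l (x l ^ j))
      rw [pow_one, ihj (by omega), if_neg (by omega), zero_mul] at h3
      rw [H.d_x_pow_succ h1 (by omega), map_add, h3, zero_add, end_apply_neg_one_pow_mul,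
        ih (by omega) (by omega) (by omega), Nat.choose_succ_succ' k 1, Nat.choose_one_right,
        pow_add]
      by_cases hjk : j = k <;> simp [hjk]

theorem downWord_x_pow {l k j : ℕ} (h1 : 1 ≤ l) (h2 : l + k ≤ n) (hj : j ≤ k) :
    downWord d l k (x (l + k) ^ j) = if j = k then (-1) ^ k.choose 2 else 0 := by
  induction k generalizing j with
  | zero => obtain rfl : j = 0 := by omega
            simp [downWord]
  | succ k ih =>
    rw [downWord, end_mul_apply, ← add_assoc]
    induction j with
    | zero => simp [H.d_one (l + k) (by omega) (by omega)]
    | succ j ihj =>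
      have h3 := H.downWord_mul_x_pow (l := l) (k := k) (j := l + k + 1) (by omega) 1
        (d (l + k) (x (l + k + 1) ^ j))
      rw [pow_one, ihj (by omega), if_neg (by omega), zero_mul] at h3
      rw [H.d_x_succ_pow_succ (by omega) (by omega), map_add, h3, zero_add,
        end_apply_neg_one_pow_mul, ih (by omega) (by omega), Nat.choose_succ_succ' k 1,
        Nat.choose_one_right, pow_add]
      by_cases hjk : j = k <;> simp [hjk]

theorem longWord_succ_up (l k : ℕ) (f : A) :
    longWord d l (k + 1) f = (-1) ^ (k * k.choose 2) * upWord d l k (longWord d (l + 1) k f) := by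
  rw [longWord_succ_eq_upWord_mul H.d_far H.d_braid, end_mul_apply,
    neg_one_pow_end_apply]; rfl

theorem longWord_succ_down (l k : ℕ) (f : A) :
    longWord d l (k + 1) f = (-1) ^ k.choose 3 * downWord d l k (longWord d l k f) := by
  rw [longWord_succ_eq_downWord_mul H.d_far, end_mul_apply,
    neg_one_pow_end_apply]; rfl

theorem longWord_x_pow_mul_of_eq_int {l k p : ℕ} {f : A} {z : ℤ} (h1 : 1 ≤ l) (h2 : l + k ≤ n)
    (hp : p ≤ k) (hf : longWord d (l + 1) k f = z) :
    longWord d l (k + 1) (x l ^ p * f) = if p = k then (-1) ^ k.choose 2 * (z : A) else 0 := by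
  have h3 : upWord d l k (x l ^ p * (z : A)) = upWord d l k (x l ^ p) * (z : A) := by
    rw [← (Int.cast_commute z (x l ^ p)).eq, ← (Int.cast_commute z (upWord d l k (x l ^ p))).eq,
      ← zsmul_eq_mul, ← zsmul_eq_mul, map_zsmul]
  rw [H.longWord_succ_up, H.longWord_x_pow_mul (by omega), end_apply_neg_one_pow_mul, hf, h3,
    H.upWord_x_pow h1 h2 hp]
  split_ifs with h
  · subst h
    rw [← mul_assoc, ← pow_add, Even.neg_one_pow ⟨p * p.choose 2, by ring⟩, one_mul]
  · simp

theorem longWord_mul_x_pow_of_eq_int {l k : ℕ} {f : A} {z : ℤ} (h1 : 1 ≤ l) (h2 : l + k ≤ n)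
    (hf : longWord d l k f = z) :
    longWord d l (k + 1) (f * x (l + k) ^ k) = (-1) ^ (k.choose 3 + k.choose 2) * (z : A) := by
  rw [H.longWord_succ_down, H.longWord_mul_x_pow (by omega), hf, ← zsmul_eq_mul, map_zsmul,
    H.downWord_x_pow h1 h2 le_rfl, if_pos rfl, zsmul_eq_mul, (Int.cast_commute z _).eq,
    ← mul_assoc, pow_add]

/-! ### Monomials with small exponents -/

theorem d_mul_oddMon {i l : ℕ} (h : i + 1 < l) (f : A) (cs : List ℕ) :
    d i (f * oddMon x l cs) = d i f * oddMon x l cs := by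
  induction cs generalizing l f with
  | nil => simp [oddMon]
  | cons p cs ih =>
    rw [oddMon, ← mul_assoc, ih (by omega), ← mul_assoc,
      end_apply_mul_pow (H.d_commute_mulRight (by omega) (by omega))]

theorem longWord_mul_oddMon {l k m : ℕ} (h : l + k ≤ m) (f : A) (cs : List ℕ) :
    longWord d l k (f * oddMon x m cs) = longWord d l k f * oddMon x m cs := by
  have : Commute (longWord d l k) (mulRightEnd (oddMon x m cs)) :=
    longWord_commute fun i _ _ => by
      ext g
      exact H.d_mul_oddMon (by omega) g cs
  exact DFunLike.congr_fun this.eq f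

theorem d_x_pow_mul_x_pow_mem {i : ℕ} (h1 : 1 ≤ i) (h2 : i + 1 ≤ n) (p q : ℕ) :
    d i (x i ^ p * x (i + 1) ^ q) ∈ AddSubgroup.closure
      {g | ∃ p' q', g = x i ^ p' * x (i + 1) ^ q' ∧
      p' + q' + 1 = p + q ∧ p' + 1 ≤ max p q ∧ q' + 1 ≤ max p q} := by
  induction q generalizing p with
  | zero =>
    induction p with
    | zero => simp [H.d_one i h1 h2]
    | succ p ih =>
      simp only [pow_zero, mul_one] at ih ⊢
      rw [pow_succ', H.d_x_left h1 h2]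
      refine sub_mem (AddSubgroup.subset_closure ⟨p, 0, by simp, by simp, by simp, by simp⟩) ?_
      refine map_mem_of_mem_closure (mulLeftEnd (x (i + 1))) ?_ ih
      rintro _ ⟨p', q', rfl, h3, h4, h5⟩
      have h6 := H.x_pow_mul_x_pow (i := i + 1) (j := i) (by omega) 1 p'
      rw [pow_one] at h6
      change x (i + 1) * (x i ^ p' * x (i + 1) ^ q') ∈ _
      rw [← mul_assoc, h6, mul_assoc, mul_assoc, ← pow_succ']
      refine neg_one_pow_mul_mem ?_ _
      exact AddSubgroup.subset_closure ⟨p', q' + 1, rfl, by omega, by omega, by omega⟩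
  | succ q ih =>
    cases p with
    | zero =>
      have ih := ih 0
      simp only [pow_zero, one_mul] at ih ⊢
      rw [pow_succ', H.d_x_succ_left h1 h2]
      refine sub_mem (AddSubgroup.subset_closure ⟨0, q, by simp, by simp, by simp, by simp⟩) ?_
      refine map_mem_of_mem_closure (mulLeftEnd (x i)) ?_ ih
      rintro _ ⟨p', q', rfl, h3, h4, h5⟩
      change x i * (x i ^ p' * x (i + 1) ^ q') ∈ _
      rw [← mul_assoc, ← pow_succ']
      exact AddSubgroup.subset_closure ⟨p' + 1, q', rfl, by omega, by omega, by omega⟩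
    | succ p =>
      have h3 := H.x_pow_mul_x_pow (i := i) (j := i + 1) (by omega) p 1
      rw [pow_one, mul_one] at h3
      have h4 : x i ^ (p + 1) * x (i + 1) ^ (q + 1) =
          (-1) ^ p * (x i * (x (i + 1) * (x i ^ p * x (i + 1) ^ q))) := by
        rw [pow_succ', pow_succ', mul_assoc, ← mul_assoc (x i ^ p), h3, mul_assoc, ← mul_assoc,
          neg_one_pow_central]
        simp only [mul_assoc]
      have h5 : d i (x i * (x (i + 1) * (x i ^ p * x (i + 1) ^ q))) =
          x (i + 1) * (x i * d i (x i ^ p * x (i + 1) ^ q)) := by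
        rw [H.d_x_left h1 h2, H.d_x_succ_left h1 h2, mul_sub, sub_sub_cancel]
      rw [h4, end_apply_neg_one_pow_mul, h5]
      refine neg_one_pow_mul_mem ?_ _
      refine map_mem_of_mem_closure (mulLeftEnd (x (i + 1)) * mulLeftEnd (x i)) ?_ (ih p)
      rintro _ ⟨p', q', rfl, h6, h7, h8⟩
      have h9 := H.x_pow_mul_x_pow (i := i + 1) (j := i) (by omega) 1 (p' + 1)
      rw [pow_one] at h9
      change x (i + 1) * (x i * (x i ^ p' * x (i + 1) ^ q')) ∈ _
      rw [← mul_assoc (x i), ← pow_succ', ← mul_assoc, h9, mul_assoc, mul_assoc, ← pow_succ']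
      refine neg_one_pow_mul_mem ?_ _
      exact AddSubgroup.subset_closure ⟨p' + 1, q' + 1, rfl, by omega, by omega, by omega⟩

theorem upWord_oddMon_mem {K l p : ℕ} {cs : List ℕ} (h1 : 1 ≤ l) (h2 : l + cs.length ≤ n)
    (hp : p ≤ K + 1) (hcs : ∀ c ∈ cs, c ≤ K + 1) :
    upWord d l cs.length (oddMon x l (p :: cs)) ∈ AddSubgroup.closure
      {g | ∃ cs' t, g = oddMon x l (cs' ++ [t]) ∧ cs'.length = cs.length ∧ (∀ c ∈ cs', c ≤ K) ∧
        cs'.sum + t + cs.length = p + cs.sum} := by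
  induction cs generalizing l p with
  | nil =>
    refine AddSubgroup.subset_closure ⟨[], p, ?_⟩
    simp [upWord]
  | cons q cs ih =>
    simp only [List.length_cons, List.mem_cons, forall_eq_or_imp, List.sum_cons] at *
    obtain ⟨hq, hcs⟩ := hcs
    have h3 : d l (oddMon x l (p :: q :: cs)) =
        d l (x l ^ p * x (l + 1) ^ q) * oddMon x (l + 1 + 1) cs := by
      rw [oddMon, oddMon, ← mul_assoc, H.d_mul_oddMon (by omega)]
    rw [upWord_succ', end_mul_apply, h3]
    refine map_mem_of_mem_closure
      (upWord d (l + 1) cs.length * mulRightEnd (oddMon x (l + 1 + 1) cs)) ?_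
      (H.d_x_pow_mul_x_pow_mem h1 (by omega) p q)
    rintro _ ⟨p', q', rfl, h4, h5, h6⟩
    change upWord d (l + 1) cs.length (x l ^ p' * x (l + 1) ^ q' * oddMon x (l + 1 + 1) cs) ∈ _
    rw [mul_assoc, H.upWord_x_pow_mul (by omega)]
    refine neg_one_pow_mul_mem ?_ _
    refine map_mem_of_mem_closure (mulLeftEnd (x l ^ p')) ?_
      (ih (l := l + 1) (p := q') (by omega) (by omega) (by omega) hcs)
    rintro _ ⟨cs', t, rfl, h7, h8, h9⟩
    refine AddSubgroup.subset_closure ⟨p' :: cs', t, rfl, by simp [h7], ?_, ?_⟩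
    · simp only [List.mem_cons, forall_eq_or_imp]
      exact ⟨by omega, h8⟩
    · simp only [List.sum_cons]; omega

theorem d_longWord {l k : ℕ} (f : A) : d (l + k) (longWord d l (k + 2) f) = 0 := by
  rw [H.longWord_succ_up, end_apply_neg_one_pow_mul, upWord, end_mul_apply, ← end_mul_apply (d _),
    H.d_sq]
  simp

theorem eq_zero_of_d_zsmul_pow {i : ℕ} (h1 : 1 ≤ i) (h2 : i + 1 ≤ n) {e : ℕ} {z : ℤ}
    (h : d i (z • x (i + 1) ^ (e + 1)) = 0) : z = 0 := by
  obtain ⟨φ, hφ⟩ := H.x_eval (i + 1)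
  rw [map_zsmul, pow_succ', H.d_x_succ_left h1 h2] at h
  have := congrArg φ h
  simpa [hφ i h1 (by omega), hφ (i + 1) (by omega) h2] using this

theorem longWord_oddMon {m l : ℕ} {cs : List ℕ} (h1 : 1 ≤ l) (h2 : l + m ≤ n + 1)
    (hm : cs.length = m) (hcs : ∀ c ∈ cs, c < m) :
    (∃ z : ℤ, longWord d l m (oddMon x l cs) = z) ∧
      (cs.sum ≠ m.choose 2 → longWord d l m (oddMon x l cs) = 0) := by
  induction m generalizing cs with
  | zero =>
    obtain rfl := List.length_eq_zero_iff.1 hm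
    exact ⟨⟨1, by simp [longWord, oddMon]⟩, by simp⟩
  | succ k ih =>
    obtain ⟨p, cs, rfl⟩ := List.exists_cons_of_length_eq_add_one hm
    simp only [List.length_cons, Nat.add_right_cancel_iff, List.mem_cons,
      forall_eq_or_imp] at hm hcs
    obtain ⟨hp, hcs⟩ := hcs
    cases k with
    | zero =>
      obtain rfl := List.length_eq_zero_iff.1 hm
      obtain rfl : p = 0 := by omega
      exact ⟨⟨1, by simp [longWord, oddMon, upWord]⟩, by simp⟩
    | succ K =>
      set F := longWord d l (K + 1 + 1) (oddMon x l (p :: cs)) with hF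
      have h3 : F ∈ AddSubgroup.closure
          {g | ∃ e, g = x (l + (K + 1)) ^ e ∧ e + (K + 1 + 1).choose 2 = (p :: cs).sum} := by
        rw [hF, longWord, end_mul_apply]
        have h4 := H.upWord_oddMon_mem (K := K) (p := p) (cs := cs) h1 (by omega) (by omega)
          fun c hc => by have := hcs c hc; omega
        rw [hm] at h4
        refine map_mem_of_mem_closure _ ?_ h4
        rintro _ ⟨cs', t, rfl, h5, h6, h7⟩
        obtain ⟨⟨z, hz⟩, h0⟩ := ih (cs := cs') (by omega) h5 fun c hc => by
          have := h6 c hc; omega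
        rw [oddMon_concat, h5, H.longWord_mul_x_pow (by omega)]
        by_cases hs : cs'.sum = (K + 1).choose 2
        · rw [hz, ← zsmul_eq_mul]
          refine zsmul_mem ?_ z
          refine AddSubgroup.subset_closure ⟨t, rfl, ?_⟩
          rw [Nat.choose_succ_succ' (K + 1) 1, Nat.choose_one_right, List.sum_cons,
            one_add_one_eq_two]
          omega
        · simp [h0 hs]
      by_cases he : ∃ e, e + (K + 1 + 1).choose 2 = (p :: cs).sum
      · obtain ⟨e, he⟩ := he
        have h4 : F ∈ AddSubgroup.zmultiples (x (l + (K + 1)) ^ e) := by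
          rw [AddSubgroup.zmultiples_eq_closure]
          refine (AddSubgroup.closure_mono ?_) h3
          rintro _ ⟨e', rfl, he'⟩
          obtain rfl : e = e' := by omega
          rfl
        obtain ⟨z, hz⟩ := AddSubgroup.mem_zmultiples_iff.1 h4
        cases e with
        | zero => exact ⟨⟨z, by rw [← hz]; simp⟩, fun h => absurd he.symm (by simpa using h)⟩
        | succ e =>
          have h5 : z = 0 := by
            refine H.eq_zero_of_d_zsmul_pow (i := l + K) (e := e) (by omega) (by omega) ?_
            rw [add_assoc, hz, hF]
            exact H.d_longWord _
          have h6 : F = 0 := by rw [← hz, h5, zero_smul]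
          exact ⟨⟨0, by simpa using h6⟩, fun _ => h6⟩
      · have h6 : F = 0 := by
          have : {g | ∃ e, g = x (l + (K + 1)) ^ e ∧ e + (K + 1 + 1).choose 2 = (p :: cs).sum}
              = ∅ := by
            ext g
            simp only [Set.mem_ofPred_eq, Set.mem_empty_iff_false, iff_false]
            rintro ⟨e, -, h⟩
            exact he ⟨e, h⟩
          rw [this, AddSubgroup.closure_empty] at h3
          exact h3
        exact ⟨⟨0, by simpa using h6⟩, fun _ => h6⟩

theorem longWord_oddMon_eq_zero {m l : ℕ} {cs : List ℕ} (h1 : 1 ≤ l) (h2 : l + m ≤ n + 1)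
    (hm : cs.length = m) (hm0 : m ≠ 0) (hcs : ∀ c ∈ cs, c + 1 < m) :
    longWord d l m (oddMon x l cs) = 0 := by
  obtain ⟨k, rfl⟩ := Nat.exists_eq_succ_of_ne_zero hm0
  obtain ⟨p, cs, rfl⟩ := List.exists_cons_of_length_eq_add_one hm
  simp only [List.length_cons, Nat.succ_eq_add_one, Nat.add_right_cancel_iff, List.mem_cons,
    forall_eq_or_imp] at hm hcs h2
  obtain ⟨z, hz⟩ := (H.longWord_oddMon (l := l + 1) (by omega) (by omega) hm
    fun c hc => by have := hcs.2 c hc; omega).1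
  rw [oddMon, Nat.succ_eq_add_one, H.longWord_x_pow_mul_of_eq_int h1 (by omega) (by omega) hz,
    if_neg (by omega)]

theorem longWord_add_right_eq_zero {l m : ℕ} {f : A} (h : longWord d l m f = 0) (j : ℕ) :
    longWord d l (m + j) f = 0 := by
  induction j with
  | zero => exact h
  | succ j ih => rw [← add_assoc, H.longWord_succ_down, ih]; simp

theorem longWord_add_left_eq_zero {l m j : ℕ} {f : A} (h : longWord d (l + j) m f = 0) :
    longWord d l (m + j) f = 0 := by
  induction j generalizing l with
  | zero => exact h
  | succ j ih =>
    rw [← add_assoc, H.longWord_succ_up, ih (by rw [← h]; congr 2; ring)]; simp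

theorem longWord_oddMon_mul_eq_zero {l k m : ℕ} {u : List ℕ} {f : A} (hu : l + u.length ≤ m)
    (h : longWord d m k f = 0) : longWord d m k (oddMon x l u * f) = 0 := by
  induction u generalizing l with
  | nil => simpa [oddMon] using h
  | cons p u ih =>
    rw [List.length_cons] at hu
    rw [oddMon, mul_assoc, H.longWord_x_pow_mul (by omega), ih (by omega)]; simp

/-- A block of exponents violating the staircase bound is annihilated. -/
theorem longWord_oddMon_append_eq_zero {l : ℕ} {u v w : List ℕ} (h1 : 1 ≤ l)
    (h2 : l + (u ++ v ++ w).length ≤ n + 1) (hv0 : v.length ≠ 0)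
    (hv : ∀ c ∈ v, c + 1 < v.length) :
    longWord d l (u ++ v ++ w).length (oddMon x l (u ++ v ++ w)) = 0 := by
  have h3 : (u ++ v ++ w).length = v.length + w.length + u.length := by
    simp only [List.length_append]; ring
  rw [h3] at h2 ⊢
  refine H.longWord_add_left_eq_zero (H.longWord_add_right_eq_zero ?_ _)
  rw [List.append_assoc, oddMon_append]
  refine H.longWord_oddMon_mul_eq_zero le_rfl ?_
  rw [oddMon_append, H.longWord_mul_oddMon le_rfl,
    H.longWord_oddMon_eq_zero (by omega) (by omega) rfl hv0 hv, zero_mul]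

theorem longWord_oddMon_of_nodup {ps qs : List ℕ} {m l : ℕ} (h1 : 1 ≤ l) (h2 : l + m ≤ n + 1)
    (hps : ps.Pairwise (· > ·)) (hqs : qs.Pairwise (· < ·)) (hnd : (ps ++ qs).Nodup)
    (hlt : ∀ c ∈ ps ++ qs, c < m) (hm : (ps ++ qs).length = m) :
    longWord d l m (oddMon x l (ps ++ qs)) =
      (((-1) ^ (m.choose 3 + (qs.map (·.choose 3)).sum) : ℤ) : A) := by
  induction m generalizing ps qs l with
  | zero =>
    obtain ⟨rfl, rfl⟩ := List.append_eq_nil_iff.1 (List.length_eq_zero_iff.1 hm)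
    simp [longWord, oddMon]
  | succ k ih =>
    have hk : k ∈ ps ++ qs := by
      have h3 : (ps ++ qs).toFinset = Finset.range (k + 1) := by
        refine Finset.eq_of_subset_of_card_le (fun c hc => ?_) ?_
        · exact Finset.mem_range.2 (hlt c (List.mem_toFinset.1 hc))
        · rw [List.toFinset_card_of_nodup hnd, hm, Finset.card_range]
      rw [← List.mem_toFinset, h3]
      simp
    rcases List.mem_append.1 hk with hk | hk
    · cases ps with
      | nil => simp at hk
      | cons p ps =>
        obtain rfl : k = p := by
          rcases List.mem_cons.1 hk with rfl | hk
          · rfl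
          · have := (List.pairwise_cons.1 hps).1 k hk
            have := hlt p (by simp)
            omega
        rw [List.cons_append] at hnd hlt hm ⊢
        have h3 := ih (l := l + 1) (by omega) (by omega) (List.pairwise_cons.1 hps).2 hqs
          (List.nodup_cons.1 hnd).2 (fun c hc => by
            have := hlt c (List.mem_cons_of_mem _ hc)
            have : c ≠ k := fun h => (List.nodup_cons.1 hnd).1 (h ▸ hc)
            omega) (by simpa using hm)
        rw [oddMon, H.longWord_x_pow_mul_of_eq_int h1 (by omega) le_rfl h3, if_pos rfl,
          Nat.choose_succ_succ' k 2, add_assoc, pow_add (-1 : ℤ) (k.choose 2)]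
        push_cast
        rfl
    · rcases List.eq_nil_or_concat qs with rfl | ⟨qs, q, rfl⟩
      · simp at hk
      · rw [List.concat_eq_append] at *
        have hq := List.pairwise_append.1 hqs
        obtain rfl : k = q := by
          rcases List.mem_append.1 hk with hk | hk
          · have := hq.2.2 k hk q (by simp)
            have := hlt q (by simp)
            omega
          · simpa using hk
        rw [← List.append_assoc] at hnd hlt hm ⊢
        have hnd' := List.nodup_append.1 hnd
        have hm' : (ps ++ qs).length = k := by
          rw [List.length_append, List.length_singleton] at hm; omega
        have h3 := ih h1 (by omega) hps hq.1 hnd'.1 (fun c hc => by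
            have := hlt c (List.mem_append_left _ hc)
            have : c ≠ k := hnd'.2.2 c hc k (by simp)
            omega) hm'
        rw [oddMon_concat, hm', H.longWord_mul_x_pow_of_eq_int h1 (by omega) h3,
          Nat.choose_succ_succ' k 2]
        simp only [List.map_append, List.sum_append, List.map_cons, List.map_nil, List.sum_cons,
          List.sum_nil]
        push_cast
        rw [← pow_add]
        have : k.choose 3 + k.choose 2 + (k.choose 3 + (qs.map (·.choose 3)).sum) =
          k.choose 2 + k.choose (2 + 1) + ((qs.map (·.choose 3)).sum + (k.choose 3 + 0)) := by
          simp only [two_add_one_eq_three]; ring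
        rw [this]

omit H in
theorem sum_eq_sum_range_countP {cs : List ℕ} {m : ℕ} (hlt : ∀ c ∈ cs, c < m) :
    cs.sum = ∑ t ∈ Finset.range m, cs.countP (t < ·) := by
  induction cs with
  | nil => simp
  | cons c cs ih =>
    have hc : c < m := hlt c (by simp)
    simp only [List.sum_cons, List.countP_cons, Finset.sum_add_distrib, decide_eq_true_eq]
    rw [ih fun c' h => hlt c' (List.mem_cons_of_mem _ h), ← Finset.card_filter, add_comm]
    congr 1
    rw [show (Finset.range m).filter (· < c) = Finset.range c by ext; simp; omega,
      Finset.card_range]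

omit H in
theorem countP_lt_succ (cs : List ℕ) (t : ℕ) :
    cs.countP (· < t + 1) = cs.countP (· < t) + cs.count t := by
  induction cs with
  | nil => simp
  | cons c cs ih =>
    simp only [List.countP_cons, List.count_cons, ih, decide_eq_true_eq, beq_iff_eq]
    split_ifs <;> omega

omit H in
theorem countP_lt_succ_add_countP_lt (cs : List ℕ) (t : ℕ) :
    cs.countP (· < t + 1) + cs.countP (t < ·) = cs.length := by
  induction cs with
  | nil => simp
  | cons c cs ih =>
    simp only [List.countP_cons, decide_eq_true_eq, List.length_cons]
    split_ifs <;> omega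

omit H in
theorem sum_ne_choose_two_of_not_nodup {cs : List ℕ} (hlt : ∀ c ∈ cs, c < cs.length)
    (hle : ∀ t, cs.countP (· < t) ≤ t) (hnd : ¬cs.Nodup) : cs.sum ≠ cs.length.choose 2 := by
  intro hsum
  apply hnd
  have h1 : ∀ t ∈ Finset.range cs.length, cs.length - 1 - t ≤ cs.countP (t < ·) := by
    intro t _
    have h2 := hle (t + 1)
    have h3 := countP_lt_succ_add_countP_lt cs t
    omega
  have h2 : ∑ t ∈ Finset.range cs.length, (cs.length - 1 - t) = cs.length.choose 2 := by
    rw [Finset.sum_range_reflect (fun t => t), Finset.sum_range_id, Nat.choose_two_right]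
  have h3 := (Finset.sum_eq_sum_iff_of_le h1).1
    (by rw [h2, ← sum_eq_sum_range_countP hlt, hsum])
  have h4 : ∀ t, t ≤ cs.length → cs.countP (· < t) = t := by
    intro t ht
    cases t with
    | zero => simp
    | succ t =>
      have h5 := h3 t (by simpa using ht)
      have h6 := countP_lt_succ_add_countP_lt cs t
      omega
  rw [List.nodup_iff_count_le_one]
  intro t
  by_cases ht : t ∈ cs
  · have h5 := hlt t ht
    have h6 := countP_lt_succ cs t
    rw [h4 t h5.le, h4 (t + 1) h5] at h6
    omega
  · simp [List.count_eq_zero_of_not_mem ht]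

omit H in
theorem filter_append_filter_of_pairwise_gt {ps : List ℕ} (h : ps.Pairwise (· > ·)) (t : ℕ) :
    ps.filter (t ≤ ·) ++ ps.filter (· < t) = ps := by
  induction ps with
  | nil => simp
  | cons p ps ih =>
    rw [List.pairwise_cons] at h
    by_cases hp : t ≤ p
    · simp [hp, ih h.2]
    · have h1 : ps.filter (t ≤ ·) = [] := by
        simp only [List.filter_eq_nil_iff, decide_eq_true_eq]
        intro c hc
        have := h.1 c hc
        omega
      simp only [List.filter_cons, decide_eq_true_eq, hp, not_le.1 hp, if_true, if_false, h1,
        List.nil_append, List.cons.injEq, true_and]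
      simpa [h1] using ih h.2

omit H in
theorem filter_append_filter_of_pairwise_lt {qs : List ℕ} (h : qs.Pairwise (· < ·)) (t : ℕ) :
    qs.filter (· < t) ++ qs.filter (t ≤ ·) = qs := by
  induction qs with
  | nil => simp
  | cons q qs ih =>
    rw [List.pairwise_cons] at h
    by_cases hq : q < t
    · simp [hq, ih h.2]
    · have h1 : qs.filter (· < t) = [] := by
        simp only [List.filter_eq_nil_iff, decide_eq_true_eq]
        intro c hc
        have := h.1 c hc
        omega
      have h2 := ih h.2
      rw [h1, List.nil_append] at h2
      simp [not_lt.1 hq, h1, h2]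

theorem longWord_oddMon_of_not_nodup {ps qs : List ℕ} {l : ℕ} (h1 : 1 ≤ l)
    (h2 : l + (ps ++ qs).length ≤ n + 1)
    (hps : ps.Pairwise (· > ·)) (hqs : qs.Pairwise (· < ·)) (hnd : ¬(ps ++ qs).Nodup)
    (hlt : ∀ c ∈ ps ++ qs, c < (ps ++ qs).length) :
    longWord d l (ps ++ qs).length (oddMon x l (ps ++ qs)) = 0 := by
  by_cases h : ∀ t, (ps ++ qs).countP (· < t) ≤ t
  · exact (H.longWord_oddMon h1 h2 rfl hlt).2 (sum_ne_choose_two_of_not_nodup hlt h hnd)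
  · push Not at h
    obtain ⟨t, ht⟩ := h
    have h3 : ps ++ qs = ps.filter (t ≤ ·) ++ (ps ++ qs).filter (· < t) ++ qs.filter (t ≤ ·) := by
      conv_lhs => rw [← filter_append_filter_of_pairwise_gt hps t,
        ← filter_append_filter_of_pairwise_lt hqs t]
      simp [List.filter_append]
    rw [List.countP_eq_length_filter] at ht
    rw [h3]
    refine H.longWord_oddMon_append_eq_zero h1 (h3 ▸ h2) (by omega) fun c hc => ?_
    have : c < t := by simpa using (List.mem_filter.1 hc).2
    omega

end IsOddDiff

end OddPolynomials

/-! ### Double staircases in a box -/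

section DoubleStaircase

theorem mem_iff_lt_card_of_isLowerSet {b : ℕ} {S : Finset (Fin b)}
    (hS : IsLowerSet (S : Set (Fin b))) (j : Fin b) : j ∈ S ↔ (j : ℕ) < S.card := by
  constructor
  · intro hj
    have h : Finset.Iic j ⊆ S := fun k hk => hS (Finset.mem_Iic.1 hk) hj
    have := Finset.card_le_card h
    rw [Fin.card_Iic] at this
    omega
  · intro hj
    by_contra hjS
    have h : S ⊆ Finset.Iio j := fun k hk => Finset.mem_Iio.2 <| by
      by_contra hkj
      exact hjS (hS (not_lt.1 hkj) hk)
    have := Finset.card_le_card h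
    rw [Fin.card_Iio] at this
    omega

theorem card_filter_lt_add_card_filter_lt {a b : ℕ} {f : Fin a → ℕ} {g : Fin b → ℕ}
    (hf : Function.Injective f) (hg : Function.Injective g) (hfg : ∀ i j, f i ≠ g j)
    (hfl : ∀ i, f i < a + b) (hgl : ∀ j, g j < a + b) {t : ℕ} (ht : t ≤ a + b) :
    (Finset.univ.filter fun i => f i < t).card + (Finset.univ.filter fun j => g j < t).card =
      t := by
  have hdisj : ∀ (S : Finset (Fin a)) (T : Finset (Fin b)), Disjoint (S.image f) (T.image g) := by
    intro S T
    rw [Finset.disjoint_left]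
    intro c hc hc'
    obtain ⟨i, -, rfl⟩ := Finset.mem_image.1 hc
    obtain ⟨j, -, h⟩ := Finset.mem_image.1 hc'
    exact hfg i j h.symm
  have hcard : ∀ (S : Finset (Fin a)) (T : Finset (Fin b)),
      (S.image f ∪ T.image g).card = S.card + T.card := fun S T => by
    rw [Finset.card_union_of_disjoint (hdisj S T), Finset.card_image_of_injective _ hf,
      Finset.card_image_of_injective _ hg]
  have hall : Finset.univ.image f ∪ Finset.univ.image g = Finset.range (a + b) := by
    refine Finset.eq_of_subset_of_card_le (fun c hc => Finset.mem_range.2 ?_) ?_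
    · rcases Finset.mem_union.1 hc with h | h <;>
        obtain ⟨i, -, rfl⟩ := Finset.mem_image.1 h
      exacts [hfl i, hgl i]
    · rw [hcard]; simp
  rw [← hcard, ← Finset.card_range t]
  congr 1
  ext c
  simp only [Finset.mem_union, Finset.mem_image, Finset.mem_filter, Finset.mem_univ, true_and,
    Finset.card_range, Finset.mem_range]
  constructor
  · rintro (⟨i, h, rfl⟩ | ⟨i, h, rfl⟩) <;> exact h
  · intro hc
    have h : c ∈ Finset.univ.image f ∪ Finset.univ.image g := by
      rw [hall]; exact Finset.mem_range.2 (by omega)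
    rcases Finset.mem_union.1 h with h | h <;> obtain ⟨i, -, rfl⟩ := Finset.mem_image.1 h
    exacts [Or.inl ⟨i, hc, rfl⟩, Or.inr ⟨i, hc, rfl⟩]

variable {a b : ℕ} {α : Fin a → ℕ} {γ : Fin b → ℕ}

theorem strictAnti_staircase (hα : Antitone α) :
    StrictAnti fun i : Fin a => a - 1 - (i : ℕ) + α i := by
  intro i i' h
  have := hα h.le
  have := i'.isLt
  have : (i : ℕ) < i' := h
  change a - 1 - (i' : ℕ) + α i' < a - 1 - (i : ℕ) + α i
  omega

theorem strictMono_staircase (hγ : Monotone γ) : StrictMono fun j : Fin b => (j : ℕ) + γ j := by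
  intro j j' h
  have := hγ h.le
  have : (j : ℕ) < j' := h
  change (j : ℕ) + γ j < j' + γ j'
  omega

theorem staircase_ne_iff (hα : Antitone α) (hαb : ∀ i, α i ≤ b) (hγ : Monotone γ)
    (hγa : ∀ j, γ j ≤ a) :
    (∀ (i : Fin a) (j : Fin b), a - 1 - (i : ℕ) + α i ≠ j + γ j) ↔
      ∀ i : Fin a, α i = (Finset.univ.filter fun j : Fin b => (i : ℕ) + 1 ≤ a - γ j).card := by
  constructor
  · intro hne i
    have hp := strictAnti_staircase hα
    have hq := strictMono_staircase hγ
    have hpl : ∀ i : Fin a, a - 1 - (i : ℕ) + α i < a + b := fun i => by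
      have := hαb i; have := i.isLt; omega
    have hql : ∀ j : Fin b, (j : ℕ) + γ j < a + b := fun j => by
      have := hγa j; have := j.isLt; omega
    have key : ∀ t ≤ a + b, _ = t := fun t ht =>
      card_filter_lt_add_card_filter_lt hp.injective hq.injective hne hpl hql ht
    have h1 := key _ (hpl i).le
    simp only [hp.lt_iff_gt] at h1
    rw [Finset.filter_lt_eq_Ioi, Fin.card_Ioi] at h1
    have h2 : ∀ j : Fin b, (j : ℕ) + γ j < a - 1 - (i : ℕ) + α i ↔ (i : ℕ) + 1 ≤ a - γ j := by
      intro j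
      have h3 := key _ (hql j).le
      simp only [hq.lt_iff_lt] at h3
      rw [Finset.filter_gt_eq_Iio, Fin.card_Iio] at h3
      have hi := i.isLt
      constructor
      · intro h
        have h4 : (Finset.univ.filter fun i' : Fin a => a - 1 - (i' : ℕ) + α i' < j + γ j) ⊆
            Finset.Ioi i := fun i' hi' => Finset.mem_Ioi.2 <|
          hp.lt_iff_gt.1 ((Finset.mem_filter.1 hi').2.trans h)
        have h5 := Finset.card_le_card h4
        rw [Fin.card_Ioi] at h5
        omega
      · intro h
        by_contra h'
        have h4 : Finset.Ici i ⊆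
            (Finset.univ.filter fun i' : Fin a => a - 1 - (i' : ℕ) + α i' < j + γ j) :=
          fun i' hi' => Finset.mem_filter.2 ⟨Finset.mem_univ _,
            (hp.antitone (Finset.mem_Ici.1 hi')).trans_lt
              (lt_of_le_of_ne (not_lt.1 h') (hne i j))⟩
        have h5 := Finset.card_le_card h4
        rw [Fin.card_Ici] at h5
        omega
    simp only [h2] at h1
    omega
  · intro h i j
    have h1 : IsLowerSet
        ((Finset.univ.filter fun j : Fin b => (i : ℕ) + 1 ≤ a - γ j : Finset _) :
          Set (Fin b)) := by
      intro j j' hj hj'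
      have := hγ hj
      simp only [Finset.coe_filter, Finset.mem_univ, true_and, Set.mem_ofPred_eq] at hj' ⊢
      omega
    have h2 := mem_iff_lt_card_of_isLowerSet h1 j
    rw [← h i] at h2
    simp only [Finset.mem_filter, Finset.mem_univ, true_and] at h2
    have := i.isLt
    by_cases h3 : (j : ℕ) < α i
    · have := h2.2 h3
      omega
    · have := mt h2.1 h3
      omega

theorem staircase_nodup_iff (hα : Antitone α) (hαb : ∀ i, α i ≤ b) (hγ : Monotone γ)
    (hγa : ∀ j, γ j ≤ a) :
    ((List.ofFn fun i : Fin a => a - 1 - (i : ℕ) + α i) ++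
      (List.ofFn fun j : Fin b => (j : ℕ) + γ j)).Nodup ↔
      ∀ i : Fin a, α i = (Finset.univ.filter fun j : Fin b => (i : ℕ) + 1 ≤ a - γ j).card := by
  rw [← staircase_ne_iff hα hαb hγ hγa, List.nodup_append]
  simp only [List.nodup_ofFn.2 (strictAnti_staircase hα).injective,
    List.nodup_ofFn.2 (strictMono_staircase hγ).injective, true_and, List.forall_mem_ofFn_iff]

end DoubleStaircase

/-! ### The operators on `OPol n` -/

section Instance

variable {n : ℕ}

theorem xv_eq_zero {j : ℕ} (h : ¬(1 ≤ j ∧ j ≤ n)) : xv n j = 0 := dif_neg h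

theorem xv_succ (i : Fin n) : xv n (1 + i) = OX i := by
  rw [xv, dif_pos ⟨by omega, by omega⟩]
  congr 1
  ext
  simp

theorem xv_anticomm {i j : ℕ} (h : i ≠ j) : xv n i * xv n j = -(xv n j * xv n i) := by
  by_cases hi : 1 ≤ i ∧ i ≤ n
  · by_cases hj : 1 ≤ j ∧ j ≤ n
    · have h3 : (⟨i - 1, by omega⟩ : Fin n) ≠ ⟨j - 1, by omega⟩ := by
        simp only [ne_eq, Fin.mk.injEq]; omega
      have h4 := RingQuot.mkRingHom_rel (OddRel.anticomm _ _ h3)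
      rw [xv, xv, dif_pos hi, dif_pos hj]
      exact (map_mul _ _ _).symm.trans (h4.trans ((map_neg _ _).trans
        (congrArg Neg.neg (map_mul _ _ _))))
    · rw [xv_eq_zero hj, mul_zero, zero_mul]
      exact neg_zero.symm
  · rw [xv_eq_zero hi, mul_zero, zero_mul]
    exact neg_zero.symm

theorem closure_xv : Subring.closure (xv n '' Set.Icc 1 n) = ⊤ := by
  refine eq_top_iff.2 fun f _ => ?_
  obtain ⟨F, rfl⟩ := RingQuot.mkRingHom_surjective (OddRel n) f
  induction F using FreeAlgebra.induction with
  | grade0 r =>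
    rw [eq_intCast, map_intCast]
    exact intCast_mem _ r
  | grade1 i =>
    refine Subring.subset_closure ⟨1 + i, ⟨by omega, by omega⟩, xv_succ i⟩
  | mul F G hF hG =>
    rw [map_mul]
    exact mul_mem (hF trivial) (hG trivial)
  | add F G hF hG =>
    rw [map_add]
    exact add_mem (hF trivial) (hG trivial)

/-- The ring homomorphism sending `x_j` to `1` and every other variable to `0`. -/
noncomputable def evalSingle (n j : ℕ) : OPol n →+* ℤ :=
  RingQuot.lift ⟨(FreeAlgebra.lift ℤ fun i : Fin n => if 1 + (i : ℕ) = j then (1 : ℤ) else 0 :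
    FreeAlgebra ℤ (Fin n) →ₐ[ℤ] ℤ).toRingHom, by
      rintro _ _ ⟨i, k, h⟩
      have : (i : ℕ) ≠ k := fun h' => h (Fin.ext h')
      simp only [AlgHom.toRingHom_eq_coe, RingHom.coe_coe, map_mul, map_neg,
        FreeAlgebra.lift_ι_apply]
      split_ifs <;> omega⟩

theorem evalSingle_xv {i j : ℕ} (hi : 1 ≤ i) (hn : i ≤ n) :
    evalSingle n j (xv n i) = if i = j then 1 else 0 := by
  rw [xv, dif_pos ⟨hi, hn⟩, evalSingle, OX, RingQuot.lift_mkRingHom_apply]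
  simp [Nat.add_sub_cancel' hi]

/-- The family `d`, extended by zero outside `1 ≤ i < n`. -/
def extendByZero (d : ℕ → OPol n →+ OPol n) (i : ℕ) : AddMonoid.End (OPol n) :=
  if 1 ≤ i ∧ i + 1 ≤ n then d i else 0

theorem extendByZero_eq (d : ℕ → OPol n →+ OPol n) {i : ℕ} (h1 : 1 ≤ i) (h2 : i + 1 ≤ n) :
    extendByZero d i = d i := if_pos ⟨h1, h2⟩

theorem isOddDiff_xv {s : ℕ → OPol n →+* OPol n} {d : ℕ → OPol n →+ OPol n}
    (hs : ∀ i j : ℕ, 1 ≤ i → i + 1 ≤ n → 1 ≤ j → j ≤ n →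
      s i (xv n j) = if j = i then -xv n (i + 1) else if j = i + 1 then -xv n i else -xv n j)
    (hd1 : ∀ i : ℕ, 1 ≤ i → i + 1 ≤ n → d i 1 = 0)
    (hdx : ∀ i j : ℕ, 1 ≤ i → i + 1 ≤ n → 1 ≤ j → j ≤ n →
      d i (xv n j) = if j = i ∨ j = i + 1 then 1 else 0)
    (hdL : ∀ i : ℕ, 1 ≤ i → i + 1 ≤ n → ∀ f g : OPol n,
      d i (f * g) = d i f * g + s i f * d i g) :
    IsOddDiff n (xv n) s (extendByZero d) where
  x_out _ := xv_eq_zero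
  x_anticomm _ _ := xv_anticomm
  x_closure := closure_xv
  x_eval j := ⟨evalSingle n j, fun _ => evalSingle_xv⟩
  s_x := hs
  d_one i h1 h2 := by rw [extendByZero_eq d h1 h2]; exact hd1 i h1 h2
  d_x i j h1 h2 := by rw [extendByZero_eq d h1 h2]; exact hdx i j h1 h2
  d_mul i h1 h2 := by rw [extendByZero_eq d h1 h2]; exact hdL i h1 h2
  d_out i h := if_neg h

theorem dword_append (d : ℕ → OPol n →+ OPol n) (l l' : List ℕ) (f : OPol n) :
    dword d (l ++ l') f = dword d l (dword d l' f) := by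
  induction l with
  | nil => rfl
  | cons i l ih => exact congrArg (d i) ih

theorem dword_reverse_range {d : ℕ → OPol n →+ OPol n} {d' : ℕ → AddMonoid.End (OPol n)} {m : ℕ}
    (h : ∀ i, 1 ≤ i → i ≤ m → d' i = d i) (f : OPol n) :
    dword d ((List.range m).reverse.map (· + 1)) f = upWord d' 1 m f := by
  induction m with
  | zero => rfl
  | succ m ih =>
    rw [List.range_succ, List.reverse_append, List.reverse_singleton, List.map_append,
      dword_append, ih fun i h1 h2 => h i h1 (by omega), upWord, end_mul_apply,
      h (1 + m) (by omega) (by omega), add_comm 1 m]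
    rfl

theorem dword_DList {d : ℕ → OPol n →+ OPol n} {d' : ℕ → AddMonoid.End (OPol n)} {m : ℕ}
    (h : ∀ i, 1 ≤ i → i + 1 ≤ m → d' i = d i) (f : OPol n) :
    dword d (DList m) f = longWord d' 1 m f := by
  induction m generalizing f with
  | zero => rfl
  | succ m ih =>
    have h1 : DList (m + 1) = DList m ++ (List.range m).reverse.map (· + 1) := by
      simp [DList, List.range_succ]
    rw [h1, dword_append, ih fun i h1 h2 => h i h1 (by omega),
      dword_reverse_range fun i h1 h2 => h i h1 (by omega)]
    rfl

theorem prod_finRange_eq_oddMon {A : Type*} [Ring A] (x : ℕ → A) (l : ℕ) {m : ℕ}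
    (c : Fin m → ℕ) :
    ((List.finRange m).map fun j : Fin m => x (l + j) ^ c j).prod = oddMon x l (List.ofFn c) := by
  induction m generalizing l with
  | zero => simp [oddMon]
  | succ m ih =>
    have := ih (l + 1) fun j => c j.succ
    rw [List.finRange_succ, List.ofFn_succ, oddMon, ← this]
    simp [Function.comp_def, add_assoc, add_comm 1]

end Instance

/-- for α ∈ P(a,b) and β ∈ P(b,a),
D_{a+b}(x_1^{a−1+α_1}⋯x_a^{α_a} x_{a+1}^{β_b}⋯x_{a+b}^{b−1+β_1}) equals
(−1)^{Ω(β)+C(a+b,3)} if α = β̂ and 0 otherwise. -/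
theorem Da_plus_b_on_double_staircase (a b : ℕ) (ha : 1 ≤ a) (hb : 1 ≤ b)
    (α : Fin a → ℕ) (hαmono : Antitone α) (hαbd : ∀ i, α i ≤ b)
    (β : Fin b → ℕ) (hβmono : Antitone β) (hβbd : ∀ j, β j ≤ a)
    (s : ℕ → OPol (a + b) →+* OPol (a + b))
    (hs : ∀ i j : ℕ, 1 ≤ i → i + 1 ≤ a + b → 1 ≤ j → j ≤ a + b →
      s i (xv (a + b) j) =
        if j = i then -xv (a + b) (i + 1) else if j = i + 1 then -xv (a + b) i else -xv (a + b) j)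
    (d : ℕ → OPol (a + b) →+ OPol (a + b))
    (hd1 : ∀ i : ℕ, 1 ≤ i → i + 1 ≤ a + b → d i 1 = 0)
    (hdx : ∀ i j : ℕ, 1 ≤ i → i + 1 ≤ a + b → 1 ≤ j → j ≤ a + b →
      d i (xv (a + b) j) = if j = i ∨ j = i + 1 then 1 else 0)
    (hdL : ∀ i : ℕ, 1 ≤ i → i + 1 ≤ a + b → ∀ f g : OPol (a + b),
      d i (f * g) = d i f * g + s i f * d i g) :
    ((∀ i : Fin a, α i =
        (Finset.univ.filter fun j : Fin b => (i : ℕ) + 1 ≤ a - β (Fin.rev j)).card) →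
      dword d (DList (a + b))
        (((List.finRange (a + b)).map fun j => OX j ^
          (if h : (j : ℕ) < a then (a - 1 - (j : ℕ)) + α ⟨(j : ℕ), h⟩
           else ((j : ℕ) - a) +
             β (Fin.rev ⟨(j : ℕ) - a, by have := j.isLt; omega⟩))).prod) =
      (-1 : OPol (a + b)) ^
        ((∑ j : Fin b, Nat.choose (β (Fin.rev j) + (j : ℕ)) 3) +
          Nat.choose (a + b) 3)) ∧
    ((¬ ∀ i : Fin a, α i =
        (Finset.univ.filter fun j : Fin b => (i : ℕ) + 1 ≤ a - β (Fin.rev j)).card) →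
      dword d (DList (a + b))
        (((List.finRange (a + b)).map fun j => OX j ^
          (if h : (j : ℕ) < a then (a - 1 - (j : ℕ)) + α ⟨(j : ℕ), h⟩
           else ((j : ℕ) - a) +
             β (Fin.rev ⟨(j : ℕ) - a, by have := j.isLt; omega⟩))).prod) = 0) := by
  set γ : Fin b → ℕ := fun j => β (Fin.rev j) with hγ
  have hγmono : Monotone γ := fun j j' h => hβmono (Fin.rev_le_rev.2 h)
  have hγbd : ∀ j, γ j ≤ a := fun j => hβbd _
  have H := isOddDiff_xv hs hd1 hdx hdL
  set ps := List.ofFn fun i : Fin a => a - 1 - (i : ℕ) + α i with hps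
  set qs := List.ofFn fun j : Fin b => (j : ℕ) + γ j with hqs
  have hlen : (ps ++ qs).length = a + b := by simp [hps, hqs]
  have hpsp : ps.Pairwise (· > ·) := List.pairwise_ofFn.2 fun i j h => strictAnti_staircase hαmono h
  have hqsp : qs.Pairwise (· < ·) := List.pairwise_ofFn.2 fun i j h => strictMono_staircase hγmono h
  have hlt : ∀ c ∈ ps ++ qs, c < a + b := by
    intro c hc
    rcases List.mem_append.1 hc with h | h
    · obtain ⟨i, rfl⟩ := List.mem_ofFn.1 h
      have := hαbd i
      have := i.isLt
      omega
    · obtain ⟨j, rfl⟩ := List.mem_ofFn.1 h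
      have := hγbd j
      have := j.isLt
      omega
  have hmon : ((List.finRange (a + b)).map fun j => OX j ^
          (if h : (j : ℕ) < a then (a - 1 - (j : ℕ)) + α ⟨(j : ℕ), h⟩
           else ((j : ℕ) - a) +
             β (Fin.rev ⟨(j : ℕ) - a, by have := j.isLt; omega⟩))).prod =
      oddMon (xv (a + b)) 1 (ps ++ qs) := by
    have h1 : ps ++ qs = List.ofFn fun j : Fin (a + b) =>
        if h : (j : ℕ) < a then (a - 1 - (j : ℕ)) + α ⟨(j : ℕ), h⟩
        else ((j : ℕ) - a) + β (Fin.rev ⟨(j : ℕ) - a, by have := j.isLt; omega⟩) := by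
      rw [List.ofFn_add]
      simp [hps, hqs, hγ]
    rw [h1, ← prod_finRange_eq_oddMon]
    simp only [xv_succ]
  rw [hmon, dword_DList fun i => extendByZero_eq d]
  have hiff := staircase_nodup_iff hαmono hαbd hγmono hγbd
  refine ⟨fun h => ?_, fun h => ?_⟩
  · refine (H.longWord_oddMon_of_nodup le_rfl (by omega) hpsp hqsp (hiff.2 h) hlt hlen).trans ?_
    have h1 : (qs.map (·.choose 3)).sum = ∑ j : Fin b, Nat.choose (β (Fin.rev j) + (j : ℕ)) 3 := by
      rw [hqs, List.map_ofFn, List.sum_ofFn]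
      exact Finset.sum_congr rfl fun j _ => by rw [add_comm (β _)]; rfl
    rw [h1, add_comm (Nat.choose (a + b) 3)]
    push_cast
    rfl
  · have h1 := H.longWord_oddMon_of_not_nodup le_rfl (by omega) hpsp hqsp (mt hiff.1 h)
      (by rwa [hlen])
    rwa [hlen] at h1
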